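/- arXiv:math/0701311 — 2 statements merged into one kernel-verified Lean document; each statement's English description precedes it below -/
import Mathlib

section
/- Let K be an algebraically closed field, V and W nonzero finite-dimensional vector spaces over K, and f : V → V, g : W → W linear endomorphisms. Then every eigenvalue γ ∈ K of the endomorphism f ⊗ g of V ⊗_K W is of the form γ = α·β where α is an eigenvalue of f and β is an eigenvalue of g. -/
open TensorProduct

theorem aux_exists_eigen {K U : Type*} [Field K] [IsAlgClosed K]
    [AddCommGroup U] [Module K U] [FiniteDimensional K U]
    (T : U →ₗ[K] U) (p : Submodule K U) (hp : ∀ x ∈ p, T x ∈ p)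
    (x : U) (hx : x ∈ p) (hx0 : x ≠ 0) :
    ∃ y ∈ p, y ≠ 0 ∧ ∃ μ : K, T y = μ • y := by
  have : Nontrivial p := ⟨⟨⟨x, hx⟩, 0, fun h => hx0 (congrArg Subtype.val h)⟩⟩
  obtain ⟨μ, hμ⟩ := Module.End.exists_eigenvalue (T.restrict hp)
  obtain ⟨y, hy⟩ := hμ.exists_hasEigenvector
  refine ⟨y, y.2, fun h => hy.2 (Subtype.ext h), μ, ?_⟩
  exact congrArg Subtype.val hy.apply_eq_smul

theorem aux_hasEigenvalue {K V : Type*} [Field K] [AddCommGroup V] [Module K V]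
    (f : V →ₗ[K] V) (α : K) (h : ¬ Function.Injective (f - α • (LinearMap.id : V →ₗ[K] V))) :
    Module.End.HasEigenvalue f α := by
  rw [← LinearMap.ker_eq_bot, Submodule.eq_bot_iff] at h
  push Not at h
  obtain ⟨v, hv, hv0⟩ := h
  refine Module.End.hasEigenvalue_of_hasEigenvector (x := v) ⟨?_, hv0⟩
  rw [Module.End.mem_eigenspace_iff]
  simpa [sub_eq_zero] using hv

/-- Over an algebraically closed field `K`, for nonzero finite-dimensional `V`, `W`
and endomorphisms `f`, `g`, every eigenvalue of `f ⊗ g` is a product `α * β` of an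
eigenvalue `α` of `f` and an eigenvalue `β` of `g`. -/
theorem stmt_2 {K V W : Type*} [Field K] [IsAlgClosed K]
    [AddCommGroup V] [Module K V] [AddCommGroup W] [Module K W]
    [FiniteDimensional K V] [FiniteDimensional K W]
    [Nontrivial V] [Nontrivial W]
    (f : V →ₗ[K] V) (g : W →ₗ[K] W) (γ : K)
    (hγ : Module.End.HasEigenvalue (TensorProduct.map f g) γ) :
    ∃ α β : K, Module.End.HasEigenvalue f α ∧ Module.End.HasEigenvalue g β ∧
      γ = α * β := by
  obtain ⟨x, hx⟩ := hγ.exists_hasEigenvector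
  have hFG : ∀ z, f.rTensor W (g.lTensor V z) = TensorProduct.map f g z := fun z => by
    rw [← LinearMap.comp_apply, LinearMap.rTensor_comp_lTensor]
  have hGF : ∀ z, g.lTensor V (f.rTensor W z) = TensorProduct.map f g z := fun z => by
    rw [← LinearMap.comp_apply, LinearMap.lTensor_comp_rTensor]
  obtain ⟨y, hy, hy0, α, hα⟩ := aux_exists_eigen (f.rTensor W)
    (Module.End.eigenspace (TensorProduct.map f g) γ)
    (fun z hz => by
      rw [Module.End.mem_eigenspace_iff] at hz ⊢
      rw [← hFG, hGF, hz, map_smul]) x hx.1 hx.2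
  obtain ⟨z, hz, hz0, β, hβ⟩ := aux_exists_eigen (g.lTensor V)
    (Module.End.eigenspace (TensorProduct.map f g) γ ⊓ Module.End.eigenspace (f.rTensor W) α)
    (fun z hz => by
      rw [Submodule.mem_inf, Module.End.mem_eigenspace_iff, Module.End.mem_eigenspace_iff] at hz ⊢
      refine ⟨?_, ?_⟩
      · rw [← hGF, hFG, hz.1, map_smul]
      · rw [hFG, ← hGF, hz.2, map_smul]) y
    ⟨hy, Module.End.mem_eigenspace_iff.2 hα⟩ hy0
  rw [Submodule.mem_inf, Module.End.mem_eigenspace_iff, Module.End.mem_eigenspace_iff] at hz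
  refine ⟨α, β, aux_hasEigenvalue f α fun hi => ?_, aux_hasEigenvalue g β fun hi => ?_, ?_⟩
  · apply hz0
    apply Module.Flat.rTensor_preserves_injective_linearMap (M := W) _ hi
    rw [map_zero, LinearMap.rTensor_sub, LinearMap.rTensor_smul, LinearMap.rTensor_id]
    simp [hz.2]
  · apply hz0
    apply Module.Flat.lTensor_preserves_injective_linearMap (M := V) _ hi
    rw [map_zero, LinearMap.lTensor_sub, LinearMap.lTensor_smul, LinearMap.lTensor_id]
    simp [hβ]
  · have h := hz.1
    rw [← hGF, hz.2, map_smul, hβ, smul_smul] at h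
    exact (smul_left_injective K hz0 h).symm
end

section
/- Let K be an algebraic closure of ℚ, let M be a square matrix over K indexed by a nonempty finite type, and let c ∈ K be nonzero. Then the following are equivalent: (i) every root α ∈ K of the characteristic polynomial of M is such that α·c⁻¹ is integral over ℤ; (ii) for every integer k ≥ 1, the element trace(M^k)·c⁻ᵏ is integral over ℤ. -/
open Polynomial in
/-- The determinant of `q(M)` is the product of the values of `q` at the eigenvalues. -/
lemma aux_det_aeval {K : Type*} [Field K] [IsAlgClosed K] {n : Type*} [Fintype n] [DecidableEq n]
    (M : Matrix n n K) (q : K[X]) :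
    (aeval M q).det = (M.charpoly.roots.map (fun a => q.eval a)).prod := by
  have hcard : Multiset.card M.charpoly.roots = Fintype.card n := by
    rw [← (IsAlgClosed.splits M.charpoly).natDegree_eq_card_roots, M.charpoly_natDegree_eq_dim]
  have hC : ∀ a : K, (aeval M (C a)).det = (M.charpoly.roots.map (fun x => (C a).eval x)).prod := by
    intro a
    simp [hcard, Matrix.algebraMap_eq_diagonal]
  have hX : ∀ r : K, (aeval M (X - C r)).det
      = (M.charpoly.roots.map (fun x => (X - C r).eval x)).prod := by
    intro r
    have h1 : aeval M (X - C r) = - (Matrix.scalar n r - M) := by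
      simp [Matrix.algebraMap_eq_diagonal, Matrix.scalar_apply, Pi.algebraMap_def]
    have h2 : M.charpoly.eval r = (M.charpoly.roots.map (fun x => r - x)).prod := by
      conv_lhs => rw [(IsAlgClosed.splits M.charpoly).eq_prod_roots_of_monic M.charpoly_monic]
      rw [eval_multiset_prod]
      simp [Multiset.map_map]
    rw [h1, Matrix.det_neg, ← Matrix.eval_charpoly, h2, ← hcard]
    have h3 : (fun x : K => (X - C r).eval x) = fun x => (-1) * (r - x) := by
      ext x; simp
    rw [h3, Multiset.prod_map_mul]
    simp
  have key : ∀ s : Multiset K, (aeval M (s.map (fun r => X - C r)).prod).det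
      = (M.charpoly.roots.map (fun x => ((s.map (fun r => X - C r)).prod).eval x)).prod := by
    intro s
    induction s using Multiset.induction_on with
    | empty => simp
    | cons a s ih =>
      rw [Multiset.map_cons, Multiset.prod_cons, map_mul, Matrix.det_mul, ih, hX,
        ← Multiset.prod_map_mul]
      simp only [eval_mul]
  rw [(IsAlgClosed.splits q).eq_prod_roots, map_mul, Matrix.det_mul, hC, key,
    ← Multiset.prod_map_mul]
  simp only [eval_mul]

open Polynomial in
lemma aux_trace_aeval {K : Type*} [Field K] [IsAlgClosed K] {n : Type*} [Fintype n] [DecidableEq n]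
    (M : Matrix n n K) (p : K[X]) :
    (aeval M p).trace = (M.charpoly.roots.map (fun a => p.eval a)).sum := by
  have : Infinite K := IsAlgClosed.instInfinite
  have h : (aeval M p).charpoly
      = ((M.charpoly.roots.map (fun a => p.eval a)).map (fun a => X - C a)).prod := by
    apply Polynomial.funext
    intro t
    have h1 : Matrix.scalar n t - aeval M p = aeval M (C t - p) := by
      simp [Matrix.algebraMap_eq_diagonal, Matrix.scalar_apply, Pi.algebraMap_def]
    rw [Matrix.eval_charpoly, h1, aux_det_aeval, eval_multiset_prod]
    simp [Multiset.map_map]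
  rw [Matrix.trace_eq_sum_roots_charpoly, h, roots_multiset_prod_X_sub_C]

/-- Fatou's lemma in a number field. -/
lemma aux_fatou_nf {F : Type*} [Field F] [NumberField F]
    (e b : F) (he : e ≠ 0) (h : ∀ k : ℕ, IsIntegral ℤ (e * b ^ k)) : IsIntegral ℤ b := by
  have he' : IsIntegral ℤ e := by simpa using h 0
  obtain ⟨r, hr⟩ : ∃ r : NumberField.RingOfIntegers F,
      algebraMap (NumberField.RingOfIntegers F) F r = e := ⟨⟨e, he'⟩, rfl⟩
  have hb : IsAlmostIntegral (NumberField.RingOfIntegers F) b := by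
    refine ⟨r, ?_, fun k => ?_⟩
    · rw [mem_nonZeroDivisors_iff_ne_zero]
      rintro rfl
      exact he (by rw [← hr, map_zero])
    · rw [Algebra.smul_def, hr]
      exact ⟨⟨_, h k⟩, rfl⟩
  exact isIntegral_trans (R := ℤ) b hb.isIntegral

/-- Fatou's lemma for algebraic integers. -/
lemma aux_fatou {K : Type*} [Field K] [Algebra ℚ K] [Algebra.IsAlgebraic ℚ K]
    (e b : K) (he : e ≠ 0) (h : ∀ k : ℕ, IsIntegral ℤ (e * b ^ k)) : IsIntegral ℤ b := by
  let F := IntermediateField.adjoin ℚ ({e, b} : Set K)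
  have : CharZero K := algebraRat.charZero K
  have hfin : @FiniteDimensional ℚ F _ _ F.algebra'.toModule :=
    IntermediateField.finiteDimensional_adjoin
      (fun x _ => (Algebra.IsAlgebraic.isAlgebraic (R := ℚ) x).isIntegral)
  have hc : CharZero F := algebraRat.charZero F
  have hnf : NumberField F := { to_finiteDimensional := by convert hfin; exact Subsingleton.elim _ _ }
  let e' : F := ⟨e, IntermediateField.subset_adjoin ℚ _ (by simp)⟩
  let b' : F := ⟨b, IntermediateField.subset_adjoin ℚ _ (by simp)⟩
  let φ : F →ₐ[ℤ] K := (algebraMap F K).toIntAlgHom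
  have hφ : Function.Injective φ := (algebraMap F K).injective
  have hb2 : IsIntegral ℤ b' := by
    apply aux_fatou_nf e' b'
    · intro h0
      exact he (congrArg Subtype.val h0)
    · intro k
      rw [← isIntegral_algHom_iff φ hφ]
      exact h k
  exact hb2.map φ

open Polynomial in
/-- Let `K` be an algebraic closure of `ℚ`, `M` a square matrix over `K` indexed by a
nonempty finite type, and `c ∈ K` nonzero. Then every root `α` of the characteristic
polynomial of `M` has `α * c⁻¹` integral over `ℤ` if and only if for every `k ≥ 1`,
`trace (M ^ k) * (c ^ k)⁻¹` is integral over `ℤ`. -/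
theorem stmt_8 {K : Type*} [Field K] [Algebra ℚ K] [IsAlgClosure ℚ K]
    {n : Type*} [Fintype n] [DecidableEq n] [Nonempty n]
    (M : Matrix n n K) (c : K) (hc : c ≠ 0) :
    (∀ α : K, (Matrix.charpoly M).IsRoot α → IsIntegral ℤ (α * c⁻¹)) ↔
      (∀ k : ℕ, 1 ≤ k → IsIntegral ℤ (Matrix.trace (M ^ k) * (c ^ k)⁻¹)) := by
  classical
  have : IsAlgClosed K := IsAlgClosure.isAlgClosed ℚ
  have : Algebra.IsAlgebraic ℚ K := IsAlgClosure.isAlgebraic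
  have : CharZero K := algebraRat.charZero K
  constructor
  · intro h k _
    have h1 := aux_trace_aeval M (X ^ k)
    rw [map_pow, aeval_X] at h1
    rw [h1, ← Multiset.sum_map_mul_right]
    apply IsIntegral.multiset_sum
    intro x hx
    obtain ⟨a, ha, rfl⟩ := Multiset.mem_map.1 hx
    have := (h a (isRoot_of_mem_roots ha)).pow k
    simpa [mul_pow] using this
  · intro h α hα
    have h0 : ∀ k : ℕ, IsIntegral ℤ (Matrix.trace (M ^ k) * (c ^ k)⁻¹) := by
      intro k
      rcases Nat.eq_zero_or_pos k with rfl | hk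
      · simpa using (isIntegral_algebraMap (R := ℤ) (A := K) (x := (Fintype.card n : ℤ)))
      · exact h k hk
    let L : K[X] := ∏ j ∈ M.charpoly.roots.toFinset.erase α, (X - C j)
    have hL : L.eval α ≠ 0 := by
      simp only [L, eval_prod, eval_sub, eval_X, eval_C]
      rw [Finset.prod_ne_zero_iff]
      intro j hj
      exact sub_ne_zero.2 (Finset.ne_of_mem_erase hj).symm
    have hmem : α ∈ M.charpoly.roots := (mem_roots M.charpoly_monic.ne_zero).2 hα
    have hL0 : ∀ j ∈ M.charpoly.roots, j ≠ α → L.eval j = 0 := by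
      intro j hj hne
      simp only [L, eval_prod, eval_sub, eval_X, eval_C]
      exact Finset.prod_eq_zero (Finset.mem_erase.2 ⟨hne, Multiset.mem_toFinset.2 hj⟩) (sub_self j)
    have : Algebra.IsAlgebraic ℤ K := 
      (IsFractionRing.comap_isAlgebraic_iff (A := ℤ) (K := ℚ) (C := K)).2 inferInstance
    obtain ⟨d, hd, hint⟩ := Algebra.IsAlgebraic.exists_integral_multiples ℤ
      ((Finset.range (L.natDegree + 1)).image (fun l => L.coeff l * c ^ l))
    have htr : ∀ k : ℕ, (M.charpoly.roots.count α : K) * (L.eval α * α ^ k)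
        = ∑ l ∈ Finset.range (L.natDegree + 1), L.coeff l * (M ^ (l + k)).trace := by
      intro k
      have h1 := aux_trace_aeval M (L * X ^ k)
      have h2 : (aeval M (L * X ^ k)).trace
          = ∑ l ∈ Finset.range (L.natDegree + 1), L.coeff l * (M ^ (l + k)).trace := by
        rw [map_mul, map_pow, aeval_X, aeval_eq_sum_range, Finset.sum_mul, Matrix.trace_sum]
        simp [pow_add]
      rw [← h2, h1, Finset.sum_multiset_map_count, Finset.sum_eq_single α]
      · simp
      · intro j hj hne
        simp [hL0 j (Multiset.mem_toFinset.1 hj) hne]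
      · intro hn
        exact absurd (Multiset.mem_toFinset.2 hmem) hn
    apply aux_fatou ((d : K) * ((M.charpoly.roots.count α : K) * L.eval α))
    · refine mul_ne_zero (Int.cast_ne_zero.2 hd) (mul_ne_zero (Nat.cast_ne_zero.2 ?_) hL)
      exact (Multiset.count_pos.2 hmem).ne'
    · intro k
      have : (d : K) * ((M.charpoly.roots.count α : K) * L.eval α) * (α * c⁻¹) ^ k
          = ∑ l ∈ Finset.range (L.natDegree + 1),
            (d • (L.coeff l * c ^ l)) * ((M ^ (l + k)).trace * (c ^ (l + k))⁻¹) := by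
        calc _ = (d : K) * ((M.charpoly.roots.count α : K) * (L.eval α * α ^ k)) * (c ^ k)⁻¹ := by
              rw [mul_pow, inv_pow]; ring
          _ = _ := by
              rw [htr, Finset.mul_sum, Finset.sum_mul]
              refine Finset.sum_congr rfl fun l _ => ?_
              rw [zsmul_eq_mul, pow_add c]
              field_simp
      rw [this]
      apply IsIntegral.sum
      intro l hl
      exact (hint _ (Finset.mem_image_of_mem _ hl)).mul (h0 _)
end
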